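/- Let Γ=(P,L,I) be a rank-2 incidence geometry and λ ≥ 1. Suppose there exists an orientation of ALL edges of the multigraph I_λ(Γ) and a function peb : P ⊔ L → ℕ such that: (i) peb(p) + outdeg(p) = k₁ for every point p ∈ P and peb(ℓ) + outdeg(ℓ) = k₂ for every line ℓ ∈ L, and (ii) for all nonempty subsets A ⊆ P and B ⊆ L, writing W = A ∪ B, Σ_{v∈W} peb(v) + out(W) ≥ l. Then Γ is (λ,k₁,k₂,l)-sparse. -/

import Mathlib

open Finset

variable {α β : Type*} [DecidableEq α] [DecidableEq β]

/-- The source of the edge `e = ((p, ℓ), j)` of the multigraph `I_λ(Γ)` under the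
orientation `σ`: the point `p` if `σ e = true`, and the line `ℓ` otherwise. -/
def src (σ : (α × β) × ℕ → Bool) (e : (α × β) × ℕ) : α ⊕ β :=
  if σ e then Sum.inl e.1.1 else Sum.inr e.1.2

/-- The target of the edge `e = ((p, ℓ), j)` under the orientation `σ`:
the endpoint which is not the source. -/
def tgt (σ : (α × β) × ℕ → Bool) (e : (α × β) × ℕ) : α ⊕ β :=
  if σ e then Sum.inr e.1.2 else Sum.inl e.1.1

/-- The out-degree of a vertex `v`: the number of oriented edges of `D` with source `v`. -/
def outdeg (D : Finset ((α × β) × ℕ)) (σ : (α × β) × ℕ → Bool) (v : α ⊕ β) : ℕ :=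
  (D.filter fun e => src σ e = v).card

/-- `span(W)`: the number of oriented edges of `D` with both source and target in `W`. -/
def spanE (D : Finset ((α × β) × ℕ)) (σ : (α × β) × ℕ → Bool)
    (W : Finset (α ⊕ β)) : ℕ :=
  (D.filter fun e => src σ e ∈ W ∧ tgt σ e ∈ W).card

/-- `out(W)`: the number of oriented edges of `D` with source in `W` and target outside `W`. -/
def outE (D : Finset ((α × β) × ℕ)) (σ : (α × β) × ℕ → Bool)
    (W : Finset (α ⊕ β)) : ℕ :=
  (D.filter fun e => src σ e ∈ W ∧ tgt σ e ∉ W).card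

/-- A rank-2 incidence geometry with incidence set `I` is `(lam, k₁, k₂, l)`-sparse if
every nonempty subset `I'` of `I` satisfies
`lam * |I'| ≤ k₁ * |P(I')| + k₂ * |L(I')| - l`, where `P(I') × L(I')` is the support. -/
def IsSparse (lam k₁ k₂ l : ℕ) (I : Finset (α × β)) : Prop :=
  ∀ I' ⊆ I, I'.Nonempty →
    (lam : ℤ) * I'.card ≤
      (k₁ : ℤ) * (I'.image Prod.fst).card + (k₂ : ℤ) * (I'.image Prod.snd).card - l

/-- The out-degrees of the vertices of `W` sum to `span(W) + out(W)`. -/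
theorem sum_outdeg (D : Finset ((α × β) × ℕ)) (σ : (α × β) × ℕ → Bool)
    (W : Finset (α ⊕ β)) : ∑ v ∈ W, outdeg D σ v = spanE D σ W + outE D σ W := by
  have h : (D.filter fun e => src σ e ∈ W).card = ∑ v ∈ W, outdeg D σ v := by
    rw [card_eq_sum_card_fiberwise (s := D.filter fun e => src σ e ∈ W)
      (f := src σ) (t := W)
      fun e he => (mem_filter.1 (mem_coe.1 he)).2]
    refine sum_congr rfl fun v hv => ?_
    rw [outdeg, filter_filter]
    congr 1
    refine filter_congr fun e _ => ⟨fun h => h.2, fun h => ⟨h ▸ hv, h⟩⟩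
  rw [← h, spanE, outE, ← filter_filter, ← filter_filter, card_filter_add_card_filter_not]

/-- All copies of the incidences of a subset `J` of `I` are spanned by the support of `J`. -/
theorem mul_card_le_spanE (lam : ℕ) {I J : Finset (α × β)} (hJ : J ⊆ I)
    (σ : (α × β) × ℕ → Bool) :
    lam * J.card ≤ spanE (I ×ˢ Finset.range lam) σ
      ((J.image Prod.fst).image Sum.inl ∪ (J.image Prod.snd).image Sum.inr) := by
  have h : (J ×ˢ Finset.range lam).card = lam * J.card := by
    rw [card_product, card_range, mul_comm]
  rw [← h, spanE]
  refine card_le_card fun e he => ?_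
  obtain ⟨he₁, he₂⟩ := mem_product.1 he
  have hp := mem_image_of_mem Prod.fst he₁
  have hl := mem_image_of_mem Prod.snd he₁
  refine mem_filter.2 ⟨mem_product.2 ⟨hJ he₁, he₂⟩, ?_⟩
  have hp' := mem_union_left ((J.image Prod.snd).image Sum.inr)
    (mem_image_of_mem (Sum.inl : α → α ⊕ β) hp)
  have hl' := mem_union_right ((J.image Prod.fst).image Sum.inl)
    (mem_image_of_mem (Sum.inr : β → α ⊕ β) hl)
  unfold src tgt
  split
  · exact ⟨hp', hl'⟩
  · exact ⟨hl', hp'⟩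

/-- If all edges of `I_λ(Γ)` are oriented and there is a pebble assignment satisfying the
pebble-game invariants, then `Γ` is `(λ, k₁, k₂, l)`-sparse. -/
theorem sparse_of_orientation (lam k₁ k₂ l : ℕ) (hlam : 1 ≤ lam)
    (P : Finset α) (L : Finset β) (I : Finset (α × β)) (hI : I ⊆ P ×ˢ L)
    (σ : (α × β) × ℕ → Bool) (peb : α ⊕ β → ℕ)
    (hpebP : ∀ p ∈ P, peb (Sum.inl p) + outdeg (I ×ˢ Finset.range lam) σ (Sum.inl p) = k₁)
    (hpebL : ∀ x ∈ L, peb (Sum.inr x) + outdeg (I ×ˢ Finset.range lam) σ (Sum.inr x) = k₂)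
    (hout : ∀ A ⊆ P, ∀ B ⊆ L, A.Nonempty → B.Nonempty →
      l ≤ (∑ v ∈ A.image Sum.inl ∪ B.image Sum.inr, peb v)
          + outE (I ×ˢ Finset.range lam) σ (A.image Sum.inl ∪ B.image Sum.inr)) :
    IsSparse lam k₁ k₂ l I := by
  intro J hJ hne
  set A := J.image Prod.fst with hA
  set B := J.image Prod.snd with hB
  have hAP : A ⊆ P := image_subset_iff.2 fun x hx => (mem_product.1 (hI (hJ hx))).1
  have hBL : B ⊆ L := image_subset_iff.2 fun x hx => (mem_product.1 (hI (hJ hx))).2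
  have hl := hout A hAP B hBL (hne.image _) (hne.image _)
  have hspan := mul_card_le_spanE lam hJ σ
  rw [← hA, ← hB] at hspan
  have hdeg := sum_outdeg (I ×ˢ Finset.range lam) σ (A.image Sum.inl ∪ B.image Sum.inr)
  have hdisj : Disjoint (A.image (Sum.inl : α → α ⊕ β)) (B.image Sum.inr) := by
    simp [disjoint_left]
  have htotal : ∑ v ∈ A.image Sum.inl ∪ B.image Sum.inr,
      (peb v + outdeg (I ×ˢ Finset.range lam) σ v) = k₁ * A.card + k₂ * B.card := by
    rw [sum_union hdisj, sum_image Sum.inl_injective.injOn, sum_image Sum.inr_injective.injOn,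
      sum_congr rfl fun p hp => hpebP p (hAP hp), sum_congr rfl fun x hx => hpebL x (hBL hx)]
    simp [mul_comm]
  rw [sum_add_distrib] at htotal
  have key : lam * J.card + l ≤ k₁ * A.card + k₂ * B.card := by omega
  zify at key
  linarith
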